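/- Under the reverse (f,Γ)-GAN assumptions (see context), the following error decomposition holds ℙ-almost surely: D_f^Γ(P_{θ*_{n,m}}‖Q) − inf_{θ∈Θ} D_f^Γ(P_θ‖Q) ≤ sup_{h∈Γ̃,θ∈Θ}{ E_{P_Z}[h∘Φ_θ] − E_{P_{Z,m}}[h∘Φ_θ] } + sup_{h∈Γ̃,θ∈Θ}{ E_{P_{Z,m}}[h∘Φ_θ] − E_{P_Z}[h∘Φ_θ] } + sup_{h∈Γ̃}{ Λ_f^{Q_n}[h] − Λ_f^Q[h] } + sup_{h∈Γ̃}{ Λ_f^Q[h] − Λ_f^{Q_n}[h] } + (1 + (f*)'_+(z₀+β−α)) sup_{h∈Γ} inf_{h̃∈Γ̃} ‖h−h̃‖_∞ + ε^{opt}_{n,m}. -/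

import Mathlib

open MeasureTheory Set Filter Topology
open scoped ENNReal NNReal Classical

noncomputable section

/-- The interval `(a, b)` with `b` possibly infinite. -/
def Dom (a : ℝ) (b : EReal) : Set ℝ := {t : ℝ | a < t ∧ (t : EReal) < b}

/-- Legendre transform of `f` on `(a,b)`, with values in `(-∞, ∞]` (modeled by `EReal`). -/
def fStar (f : ℝ → ℝ) (a : ℝ) (b : EReal) (z : ℝ) : EReal :=
  ⨆ t ∈ Dom a b, ((z * t - f t : ℝ) : EReal)

/-- Real-valued version of the Legendre transform (junk value where it is `⊤`). -/
def fStarR (f : ℝ → ℝ) (a : ℝ) (b : EReal) (z : ℝ) : ℝ := (fStar f a b z).toReal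

/-- Right derivative of `g` at `z`. -/
def rderiv (g : ℝ → ℝ) (z : ℝ) : ℝ := derivWithin g (Ici z) z

/-- `z₀ := f'_+(1)`. -/
def zz (f : ℝ → ℝ) : ℝ := rderiv f 1

/-- Integral of an `EReal`-valued function: the Bochner integral if the function is
a.e. finite and integrable, and `⊤` otherwise. -/
def eIntegral {X : Type*} [MeasurableSpace X] (P : Measure X) (g : X → EReal) : EReal :=
  if (∀ᵐ x ∂P, g x ≠ ⊤) ∧ Integrable (fun x => (g x).toReal) P
  then ((∫ x, (g x).toReal ∂P : ℝ) : EReal) else ⊤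

/-- The generalized cumulant generating function `Λ_f^P[h]`. -/
def cgf {X : Type*} [MeasurableSpace X] (f : ℝ → ℝ) (a : ℝ) (b : EReal)
    (P : Measure X) (h : X → ℝ) : EReal :=
  ⨅ ν : ℝ, ((ν : EReal) + eIntegral P (fun x => fStar f a b (h x - ν)))

/-- Real-valued `Λ_f^P[h]`. -/
def cgfR {X : Type*} [MeasurableSpace X] (f : ℝ → ℝ) (a : ℝ) (b : EReal)
    (P : Measure X) (h : X → ℝ) : ℝ := (cgf f a b P h).toReal

/-- `Λ_f : ℝⁿ → ℝ` (with values in `EReal`). -/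
def lamVec (f : ℝ → ℝ) (a : ℝ) (b : EReal) {n : ℕ} (x : Fin n → ℝ) : EReal :=
  ⨅ ν : ℝ, ((ν : EReal) + ((n : ℝ)⁻¹ : EReal) * ∑ i, fStar f a b (x i - ν))

/-- Empirical measure of `n` points. -/
def empMeas {X : Type*} [MeasurableSpace X] (n : ℕ) (xs : Fin n → X) : Measure X :=
  (n : ℝ≥0∞)⁻¹ • ∑ i, Measure.dirac (xs i)

/-- The `(f,Γ)`-divergence `D_f^Γ(Q‖P)`. -/
def Dfg {X : Type*} [MeasurableSpace X] (f : ℝ → ℝ) (a : ℝ) (b : EReal)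
    (Γ : Set (X → ℝ)) (Q P : Measure X) : ℝ :=
  sSup {r : ℝ | ∃ h ∈ Γ, r = ∫ x, h x ∂Q - cgfR f a b P h}

/-- Empirical Rademacher complexity of `Ψ` at the sample `y`. -/
def empRad {Y : Type*} (Ψ : Set (Y → ℝ)) (n : ℕ) (y : Fin n → Y) : ℝ :=
  (2 ^ n : ℝ)⁻¹ * ∑ σ : Fin n → Bool,
    sSup {r : ℝ | ∃ ψ ∈ Ψ, r = (n : ℝ)⁻¹ * ∑ i, (if σ i then 1 else -1) * ψ (y i)}

/-- Rademacher complexity of `Ψ` relative to `P` with `n` samples. -/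
def rad {Y : Type*} [MeasurableSpace Y] (Ψ : Set (Y → ℝ)) (P : Measure Y) (n : ℕ) : ℝ :=
  ∫ y, empRad Ψ n y ∂(Measure.pi fun _ : Fin n => P)

/-- `Δ_{f,n}`. -/
def Δq (f : ℝ → ℝ) (a : ℝ) (b : EReal) (α β : ℝ) (n : ℕ) : ℝ :=
  sInf ((fun z => (n : ℝ) * (-z + (((n : ℝ) - 1) / (n : ℝ)) * fStarR f a b z
      + (1 / (n : ℝ)) * fStarR f a b (β - α + z))) '' Icc (zz f - (β - α)) (zz f))

/-- `sup_{h ∈ Γ} inf_{h̃ ∈ Γ̃} ‖h − h̃‖_∞`. -/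
def approxErr {X : Type*} (Γ Γt : Set (X → ℝ)) : ℝ :=
  sSup {r : ℝ | ∃ h ∈ Γ, r = sInf {s : ℝ | ∃ ht ∈ Γt, s = ⨆ x, |h x - ht x|}}

/-- A countable subset which is pointwise-limit dense. -/
def PtwiseDenseCount {X : Type*} (Γ : Set (X → ℝ)) : Prop :=
  ∃ Γ₀ ⊆ Γ, Γ₀.Countable ∧ ∀ h ∈ Γ, ∃ s : ℕ → X → ℝ,
    (∀ j, s j ∈ Γ₀) ∧ ∀ x, Tendsto (fun j => s j x) atTop (𝓝 (h x))

/-- The quantity `K_{f,Ψ,P,n}` from Definition 3.4: either `(f*)'_+` is Lipschitz on the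
relevant interval and `Ψ` contains a constant, in which case `K` is the minimum of the two
expressions, or `K` is the second expression. -/
def Kchoice (f : ℝ → ℝ) (a : ℝ) (b : EReal) (α β : ℝ) {Y : Type*} [MeasurableSpace Y]
    (Ψ : Set (Y → ℝ)) (P : Measure Y) (n : ℕ) (K : ℝ) : Prop :=
  (∃ L : ℝ≥0, LipschitzOnWith L (rderiv (fStarR f a b))
      (Icc (zz f - (β - α)) (zz f + (β - α))) ∧
    (∃ c : ℝ, (fun _ => c) ∈ Ψ) ∧
    K = min ((1 + 2 * (β - α) * (L : ℝ)) * rad Ψ P n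
        + (β - α) ^ 2 * (L : ℝ) / (2 * Real.sqrt n))
      (rderiv (fStarR f a b) (β - α + zz f) * (rad Ψ P n + (β - α) / (2 * Real.sqrt n))))
  ∨ K = rderiv (fStarR f a b) (β - α + zz f) * (rad Ψ P n + (β - α) / (2 * Real.sqrt n))

/-- Covering number of a (pseudo)metric space by `ε`-balls. -/
def coverNum (Θ : Type*) [PseudoMetricSpace Θ] (ε : ℝ) : ℝ≥0∞ :=
  ⨅ s ∈ {s : Finset Θ | ∀ θ : Θ, ∃ c ∈ s, dist θ c ≤ ε}, ((s.card : ℝ≥0∞))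

end

lemma coe_le_fStar {f : ℝ → ℝ} {a : ℝ} {b : EReal} {t : ℝ} (ht : t ∈ Dom a b) (z : ℝ) :
    ((z * t - f t : ℝ) : EReal) ≤ fStar f a b z :=
  le_iSup₂_of_le t ht le_rfl

lemma self_le_fStar {f : ℝ → ℝ} {a : ℝ} {b : EReal} (h1 : (1 : ℝ) ∈ Dom a b) (hf1 : f 1 = 0)
    (z : ℝ) : (z : EReal) ≤ fStar f a b z := by
  simpa [hf1] using coe_le_fStar (f := f) h1 z

lemma fStar_mono {f : ℝ → ℝ} {a : ℝ} {b : EReal} (ha0 : 0 ≤ a) : Monotone (fStar f a b) := by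
  intro x y hxy
  refine iSup₂_le fun t ht => (EReal.coe_le_coe_iff.2 ?_).trans (coe_le_fStar ht y)
  have := mul_le_mul_of_nonneg_right hxy (ha0.trans ht.1.le)
  linarith

lemma coe_fStarR {f : ℝ → ℝ} {a : ℝ} {b : EReal} (h1 : (1 : ℝ) ∈ Dom a b) (hf1 : f 1 = 0)
    {z : ℝ} (hz : fStar f a b z < ⊤) : ((fStarR f a b z : ℝ) : EReal) = fStar f a b z :=
  EReal.coe_toReal hz.ne (ne_bot_of_le_ne_bot (EReal.coe_ne_bot z) (self_le_fStar h1 hf1 z))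

lemma mul_sub_one_le {f : ℝ → ℝ} {a : ℝ} {b : EReal} (hconv : ConvexOn ℝ (Dom a b) f)
    (hf1 : f 1 = 0) (h1 : (1 : ℝ) ∈ interior (Dom a b)) {t : ℝ} (ht : t ∈ Dom a b) :
    zz f * (t - 1) ≤ f t := by
  have hzz : zz f = derivWithin f (Ioi 1) 1 := (derivWithin_Ioi_eq_Ici f 1).symm
  rcases lt_trichotomy t 1 with h | rfl | h
  · have h2 := hconv.slope_le_leftDeriv_of_mem_interior ht h1 h
    have h3 := hconv.leftDeriv_le_rightDeriv_of_mem_interior h1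
    rw [← hzz] at h3
    have h4 := h2.trans h3
    rw [slope_def_field, div_le_iff₀ (by linarith), hf1] at h4
    linarith
  · simp [hf1]
  · have h2 := hconv.rightDeriv_le_slope_of_mem_interior h1 ht h
    rw [← hzz, slope_def_field, le_div_iff₀ (by linarith), hf1] at h2
    linarith

lemma fStar_zz_le {f : ℝ → ℝ} {a : ℝ} {b : EReal} (hconv : ConvexOn ℝ (Dom a b) f)
    (hf1 : f 1 = 0) (h1 : (1 : ℝ) ∈ interior (Dom a b)) :
    fStar f a b (zz f) ≤ (zz f : EReal) := by
  refine iSup₂_le fun t ht => EReal.coe_le_coe_iff.2 ?_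
  have := mul_sub_one_le hconv hf1 h1 ht
  linarith

lemma fStarR_convexOn {f : ℝ → ℝ} {a : ℝ} {b : EReal} (h1 : (1 : ℝ) ∈ Dom a b) (hf1 : f 1 = 0) :
    ConvexOn ℝ {z : ℝ | fStar f a b z < ⊤} (fStarR f a b) := by
  have key : ∀ x ∈ {z : ℝ | fStar f a b z < ⊤}, ∀ y ∈ {z : ℝ | fStar f a b z < ⊤},
      ∀ p q : ℝ, 0 ≤ p → 0 ≤ q → p + q = 1 → fStar f a b (p • x + q • y) ≤
        ((p • fStarR f a b x + q • fStarR f a b y : ℝ) : EReal) := by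
    intro x hx y hy p q hp hq hpq
    refine iSup₂_le fun t ht => EReal.coe_le_coe_iff.2 ?_
    have hx' := coe_le_fStar (f := f) ht x
    have hy' := coe_le_fStar (f := f) ht y
    rw [← coe_fStarR h1 hf1 hx, EReal.coe_le_coe_iff] at hx'
    rw [← coe_fStarR h1 hf1 hy, EReal.coe_le_coe_iff] at hy'
    have e : (p • x + q • y) * t - f t = p * (x * t - f t) + q * (y * t - f t) := by
      simp only [smul_eq_mul]
      linear_combination (f t) * hpq
    rw [e]
    exact add_le_add (mul_le_mul_of_nonneg_left hx' hp) (mul_le_mul_of_nonneg_left hy' hq)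
  have hfin : Convex ℝ {z : ℝ | fStar f a b z < ⊤} := fun x hx y hy p q hp hq hpq =>
    (key x hx y hy p q hp hq hpq).trans_lt (EReal.coe_lt_top _)
  refine ⟨hfin, fun x hx y hy p q hp hq hpq => ?_⟩
  have := key x hx y hy p q hp hq hpq
  rwa [← coe_fStarR h1 hf1 (hfin hx hy hp hq hpq), EReal.coe_le_coe_iff] at this

lemma one_le_rderiv_fStarR {f : ℝ → ℝ} {a : ℝ} {b : EReal} (hconv : ConvexOn ℝ (Dom a b) f)
    (hf1 : f 1 = 0) (h1 : (1 : ℝ) ∈ interior (Dom a b)) {w : ℝ} (hw : zz f ≤ w)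
    (hwi : w ∈ interior {z : ℝ | fStar f a b z < ⊤}) : 1 ≤ rderiv (fStarR f a b) w := by
  have h1' := interior_subset h1
  have hF := fStarR_convexOn (f := f) h1' hf1
  rw [rderiv, ← derivWithin_Ioi_eq_Ici]
  have hd := hF.hasDerivWithinAt_rightDeriv_of_mem_interior hwi
  rw [hasDerivWithinAt_iff_tendsto_slope' (by simp)] at hd
  refine ge_of_tendsto hd ?_
  have hmem : ∀ᶠ y in 𝓝[>] w, y ∈ {z : ℝ | fStar f a b z < ⊤} :=
    nhdsWithin_le_nhds (mem_interior_iff_mem_nhds.1 hwi)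
  filter_upwards [hmem, self_mem_nhdsWithin] with y hy hwy
  rw [mem_Ioi] at hwy
  rw [slope_def_field, le_div_iff₀ (by linarith)]
  have hle : fStar f a b w ≤ ((fStarR f a b y - (y - w) : ℝ) : EReal) := by
    refine iSup₂_le fun t ht => EReal.coe_le_coe_iff.2 ?_
    have hyt := coe_le_fStar (f := f) ht y
    have hy1 := self_le_fStar (f := f) h1' hf1 y
    rw [← coe_fStarR h1' hf1 hy, EReal.coe_le_coe_iff] at hyt hy1
    have hs := mul_sub_one_le hconv hf1 h1 ht
    rcases le_total 1 t with h | h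
    · nlinarith
    · nlinarith
  have hwm : w ∈ {z : ℝ | fStar f a b z < ⊤} := interior_subset hwi
  rw [← coe_fStarR h1' hf1 hwm, EReal.coe_le_coe_iff] at hle
  linarith

lemma isProbabilityMeasure_empMeas {X : Type*} [MeasurableSpace X] {n : ℕ} (hn : 0 < n)
    (xs : Fin n → X) : IsProbabilityMeasure (empMeas n xs) := by
  refine ⟨?_⟩
  simp only [empMeas, Measure.smul_apply, Measure.finsetSum_apply, measure_univ, smul_eq_mul,
    Finset.sum_const, Finset.card_univ, Fintype.card_fin, nsmul_eq_mul, mul_one]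
  exact ENNReal.inv_mul_cancel (by exact_mod_cast hn.ne') (ENNReal.natCast_ne_top n)

lemma integrable_of_mem_Icc {X : Type*} [MeasurableSpace X] {P : Measure X} [IsFiniteMeasure P]
    {α β : ℝ} {h : X → ℝ} (hm : Measurable h) (hb : ∀ x, h x ∈ Icc α β) : Integrable h P :=
  Integrable.of_mem_Icc α β hm.aemeasurable (ae_of_all _ hb)

lemma integral_mem_Icc {X : Type*} [MeasurableSpace X] {P : Measure X} [IsProbabilityMeasure P]
    {α β : ℝ} {h : X → ℝ} (hm : Measurable h) (hb : ∀ x, h x ∈ Icc α β) :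
    ∫ x, h x ∂P ∈ Icc α β := by
  have hi := integrable_of_mem_Icc (P := P) hm hb
  constructor
  · simpa using integral_mono (integrable_const α) hi fun x => (hb x).1
  · simpa using integral_mono hi (integrable_const β) fun x => (hb x).2

lemma coe_le_eIntegral {X : Type*} [MeasurableSpace X] {P : Measure X} [IsProbabilityMeasure P]
    {g : X → EReal} {c : ℝ} (hg : ∀ x, (c : EReal) ≤ g x) : (c : EReal) ≤ eIntegral P g := by
  unfold eIntegral
  split_ifs with h
  · refine EReal.coe_le_coe_iff.2 ?_
    have : ∫ _, c ∂P ≤ ∫ x, (g x).toReal ∂P := by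
      refine integral_mono_ae (integrable_const c) h.2 ?_
      filter_upwards [h.1] with x hx
      exact EReal.toReal_le_toReal (hg x) (EReal.coe_ne_bot c) hx
    simpa using this
  · exact le_top

lemma eIntegral_mono {X : Type*} [MeasurableSpace X] {P : Measure X} [IsFiniteMeasure P]
    {g g' : X → EReal} {c : ℝ} (hg : ∀ x, (c : EReal) ≤ g x) (hgm : Measurable g)
    (hgg' : ∀ x, g x ≤ g' x) : eIntegral P g ≤ eIntegral P g' := by
  by_cases h : (∀ᵐ x ∂P, g' x ≠ ⊤) ∧ Integrable (fun x => (g' x).toReal) P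
  · have hfin : ∀ᵐ x ∂P, g x ≠ ⊤ := by
      filter_upwards [h.1] with x hx
      exact ne_top_of_le_ne_top hx (hgg' x)
    have hle : ∀ᵐ x ∂P, (g x).toReal ≤ (g' x).toReal := by
      filter_upwards [h.1] with x hx
      exact EReal.toReal_le_toReal (hgg' x)
        (ne_bot_of_le_ne_bot (EReal.coe_ne_bot c) (hg x)) hx
    have hge : ∀ᵐ x ∂P, c ≤ (g x).toReal := by
      filter_upwards [hfin] with x hx
      exact EReal.toReal_le_toReal (hg x) (EReal.coe_ne_bot c) hx
    have hint : Integrable (fun x => (g x).toReal) P :=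
      integrable_of_le_of_le hgm.ereal_toReal.aestronglyMeasurable hge hle
        (integrable_const c) h.2
    rw [eIntegral, eIntegral, if_pos h, if_pos ⟨hfin, hint⟩, EReal.coe_le_coe_iff]
    exact integral_mono_ae hint h.2 hle
  · rw [eIntegral, eIntegral, if_neg h]
    exact le_top

lemma cgf_le_cgf_add {X : Type*} [MeasurableSpace X] {f : ℝ → ℝ} {a : ℝ} {b : EReal}
    (ha0 : 0 ≤ a) (h1 : (1 : ℝ) ∈ Dom a b) (hf1 : f 1 = 0) {P : Measure X} [IsFiniteMeasure P]
    {α β c : ℝ} {h h' : X → ℝ} (hm : Measurable h) (hb : ∀ x, h x ∈ Icc α β)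
    (hh : ∀ x, h x ≤ h' x + c) : cgf f a b P h ≤ cgf f a b P h' + (c : EReal) := by
  rw [← EReal.sub_le_iff_le_add (.inl (EReal.coe_ne_bot c)) (.inl (EReal.coe_ne_top c))]
  refine le_iInf fun ν => ?_
  rw [EReal.sub_le_iff_le_add (.inl (EReal.coe_ne_bot c)) (.inl (EReal.coe_ne_top c))]
  refine (iInf_le _ (ν + c)).trans ?_
  rw [EReal.coe_add, add_right_comm]
  gcongr
  refine eIntegral_mono (c := α - (ν + c)) (fun x => ?_)
    ((fStar_mono ha0).measurable.comp (hm.sub_const _)) fun x => fStar_mono ha0 ?_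
  · refine le_trans (EReal.coe_le_coe_iff.2 ?_) (self_le_fStar h1 hf1 _)
    linarith [(hb x).1]
  · linarith [hh x]

lemma cgf_mem_Icc {X : Type*} [MeasurableSpace X] {f : ℝ → ℝ} {a : ℝ} {b : EReal}
    (ha0 : 0 ≤ a) (hconv : ConvexOn ℝ (Dom a b) f) (h1 : (1 : ℝ) ∈ interior (Dom a b))
    (hf1 : f 1 = 0) {P : Measure X} [IsProbabilityMeasure P]
    {α β : ℝ} {h : X → ℝ} (hm : Measurable h) (hb : ∀ x, h x ∈ Icc α β) :
    cgf f a b P h ∈ Icc (α : EReal) (β : EReal) := by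
  have h1' := interior_subset h1
  constructor
  · refine le_iInf fun ν => ?_
    have : ((α - ν : ℝ) : EReal) ≤ eIntegral P (fun x => fStar f a b (h x - ν)) := by
      refine coe_le_eIntegral fun x => le_trans (EReal.coe_le_coe_iff.2 ?_) (self_le_fStar h1' hf1 _)
      linarith [(hb x).1]
    calc (α : EReal) = (ν : EReal) + ((α - ν : ℝ) : EReal) := by
          rw [← EReal.coe_add]; congr 1; ring
      _ ≤ _ := by gcongr
  · refine (iInf_le _ (β - zz f)).trans ?_
    have hle : eIntegral P (fun x => fStar f a b (h x - (β - zz f))) ≤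
        eIntegral P (fun _ => (zz f : EReal)) := by
      refine eIntegral_mono (c := α - (β - zz f)) (fun x => ?_)
        ((fStar_mono ha0).measurable.comp (hm.sub_const _)) fun x => ?_
      · refine le_trans (EReal.coe_le_coe_iff.2 ?_) (self_le_fStar h1' hf1 _)
        linarith [(hb x).1]
      · refine le_trans (fStar_mono ha0 ?_) (fStar_zz_le hconv hf1 h1)
        linarith [(hb x).2]
    have hc : eIntegral P (fun _ => (zz f : EReal)) = (zz f : EReal) := by
      simp [eIntegral]
    rw [hc] at hle
    calc _ ≤ ((β - zz f : ℝ) : EReal) + (zz f : EReal) := by gcongr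
      _ = (β : EReal) := by rw [← EReal.coe_add]; congr 1; ring

lemma coe_cgfR {X : Type*} [MeasurableSpace X] {f : ℝ → ℝ} {a : ℝ} {b : EReal}
    (ha0 : 0 ≤ a) (hconv : ConvexOn ℝ (Dom a b) f) (h1 : (1 : ℝ) ∈ interior (Dom a b))
    (hf1 : f 1 = 0) {P : Measure X} [IsProbabilityMeasure P]
    {α β : ℝ} {h : X → ℝ} (hm : Measurable h) (hb : ∀ x, h x ∈ Icc α β) :
    ((cgfR f a b P h : ℝ) : EReal) = cgf f a b P h := by
  have h2 := cgf_mem_Icc ha0 hconv h1 hf1 (P := P) hm hb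
  exact EReal.coe_toReal (ne_top_of_le_ne_top (EReal.coe_ne_top β) h2.2)
    (ne_bot_of_le_ne_bot (EReal.coe_ne_bot α) h2.1)

lemma cgfR_mem_Icc {X : Type*} [MeasurableSpace X] {f : ℝ → ℝ} {a : ℝ} {b : EReal}
    (ha0 : 0 ≤ a) (hconv : ConvexOn ℝ (Dom a b) f) (h1 : (1 : ℝ) ∈ interior (Dom a b))
    (hf1 : f 1 = 0) {P : Measure X} [IsProbabilityMeasure P]
    {α β : ℝ} {h : X → ℝ} (hm : Measurable h) (hb : ∀ x, h x ∈ Icc α β) :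
    cgfR f a b P h ∈ Icc α β := by
  have h2 := cgf_mem_Icc ha0 hconv h1 hf1 (P := P) hm hb
  rw [← coe_cgfR ha0 hconv h1 hf1 hm hb] at h2
  exact ⟨EReal.coe_le_coe_iff.1 h2.1, EReal.coe_le_coe_iff.1 h2.2⟩

lemma cgfR_le_cgfR_add {X : Type*} [MeasurableSpace X] {f : ℝ → ℝ} {a : ℝ} {b : EReal}
    (ha0 : 0 ≤ a) (hconv : ConvexOn ℝ (Dom a b) f) (h1 : (1 : ℝ) ∈ interior (Dom a b))
    (hf1 : f 1 = 0) {P : Measure X} [IsProbabilityMeasure P]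
    {α β c : ℝ} {h h' : X → ℝ} (hm : Measurable h) (hb : ∀ x, h x ∈ Icc α β)
    (hm' : Measurable h') (hb' : ∀ x, h' x ∈ Icc α β)
    (hh : ∀ x, h x ≤ h' x + c) : cgfR f a b P h ≤ cgfR f a b P h' + c := by
  have h2 := cgf_le_cgf_add ha0 (interior_subset h1) hf1 (P := P) hm hb hh
  rw [← coe_cgfR ha0 hconv h1 hf1 hm hb, ← coe_cgfR ha0 hconv h1 hf1 hm' hb'] at h2
  exact_mod_cast h2

/-- Elements of `Γ` are approximated by `Γt` uniformly up to any error above `approxErr Γ Γt`. -/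
lemma exists_abs_sub_lt_of_approxErr_lt {X : Type*} [Nonempty X] {Γ Γt : Set (X → ℝ)} {α β c : ℝ}
    (hsub : Γt ⊆ Γ) (hne : Γt.Nonempty) (hbd : ∀ h ∈ Γ, ∀ x, h x ∈ Icc α β)
    (hc : approxErr Γ Γt < c) {h : X → ℝ} (hh : h ∈ Γ) :
    ∃ ht ∈ Γt, ∀ x, |h x - ht x| < c := by
  have habs : ∀ h ∈ Γ, ∀ ht ∈ Γt, ∀ x, |h x - ht x| ≤ β - α := by
    intro h hh ht hht x
    have h2 := hbd h hh x
    have h3 := hbd ht (hsub hht) x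
    rw [abs_le]
    constructor <;> linarith [h2.1, h2.2, h3.1, h3.2]
  have hlow : ∀ h : X → ℝ, BddBelow {s : ℝ | ∃ ht ∈ Γt, s = ⨆ x, |h x - ht x|} := by
    refine fun h => ⟨0, ?_⟩
    rintro _ ⟨ht, -, rfl⟩
    exact Real.iSup_nonneg fun x => abs_nonneg _
  obtain ⟨h₀, hh₀⟩ := hne
  have hup : BddAbove {r : ℝ | ∃ h ∈ Γ, r = sInf {s : ℝ | ∃ ht ∈ Γt, s = ⨆ x, |h x - ht x|}} := by
    refine ⟨β - α, ?_⟩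
    rintro _ ⟨h, hh, rfl⟩
    exact (csInf_le (hlow h) ⟨h₀, hh₀, rfl⟩).trans (ciSup_le fun x => habs h hh h₀ hh₀ x)
  have hlt := (le_csSup hup ⟨h, hh, rfl⟩).trans_lt hc
  have hnonempty : {s : ℝ | ∃ ht ∈ Γt, s = ⨆ x, |h x - ht x|}.Nonempty := ⟨_, h₀, hh₀, rfl⟩
  obtain ⟨_, ⟨ht, hht, rfl⟩, hlt'⟩ := exists_lt_of_csInf_lt hnonempty hlt
  refine ⟨ht, hht, fun x => (le_ciSup (f := fun x => |h x - ht x|) ?_ x).trans_lt hlt'⟩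
  refine ⟨β - α, ?_⟩
  rintro _ ⟨y, rfl⟩
  exact habs h hh ht hht y

lemma approxErr_nonneg {X : Type*} (Γ Γt : Set (X → ℝ)) : 0 ≤ approxErr Γ Γt := by
  refine Real.sSup_nonneg ?_
  rintro _ ⟨h, -, rfl⟩
  refine Real.sInf_nonneg ?_
  rintro _ ⟨ht, -, rfl⟩
  exact Real.iSup_nonneg fun x => abs_nonneg _

section Divergence

variable {X : Type*} [MeasurableSpace X] {f : ℝ → ℝ} {a : ℝ} {b : EReal} {α β : ℝ}
  {Γ : Set (X → ℝ)}

lemma bddAbove_Dfg (ha0 : 0 ≤ a) (hconv : ConvexOn ℝ (Dom a b) f)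
    (h1 : (1 : ℝ) ∈ interior (Dom a b)) (hf1 : f 1 = 0)
    (hmeas : ∀ h ∈ Γ, Measurable h) (hbd : ∀ h ∈ Γ, ∀ x, h x ∈ Icc α β)
    (Q P : Measure X) [IsProbabilityMeasure Q] [IsProbabilityMeasure P] :
    BddAbove {r : ℝ | ∃ h ∈ Γ, r = ∫ x, h x ∂Q - cgfR f a b P h} := by
  refine ⟨β - α, ?_⟩
  rintro _ ⟨h, hh, rfl⟩
  have h2 := integral_mem_Icc (P := Q) (hmeas h hh) (hbd h hh)
  have h3 := cgfR_mem_Icc ha0 hconv h1 hf1 (P := P) (hmeas h hh) (hbd h hh)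
  linarith [h2.2, h3.1]

lemma le_Dfg (ha0 : 0 ≤ a) (hconv : ConvexOn ℝ (Dom a b) f)
    (h1 : (1 : ℝ) ∈ interior (Dom a b)) (hf1 : f 1 = 0)
    (hmeas : ∀ h ∈ Γ, Measurable h) (hbd : ∀ h ∈ Γ, ∀ x, h x ∈ Icc α β)
    (Q P : Measure X) [IsProbabilityMeasure Q] [IsProbabilityMeasure P] {h : X → ℝ} (hh : h ∈ Γ) :
    ∫ x, h x ∂Q - cgfR f a b P h ≤ Dfg f a b Γ Q P :=
  le_csSup (bddAbove_Dfg ha0 hconv h1 hf1 hmeas hbd Q P) ⟨h, hh, rfl⟩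

lemma Dfg_le (hne : Γ.Nonempty) {Q P : Measure X} {C : ℝ}
    (hC : ∀ h ∈ Γ, ∫ x, h x ∂Q - cgfR f a b P h ≤ C) : Dfg f a b Γ Q P ≤ C := by
  obtain ⟨h₀, hh₀⟩ := hne
  refine csSup_le ⟨_, h₀, hh₀, rfl⟩ ?_
  rintro _ ⟨h, hh, rfl⟩
  exact hC h hh

lemma sub_le_Dfg (ha0 : 0 ≤ a) (hconv : ConvexOn ℝ (Dom a b) f)
    (h1 : (1 : ℝ) ∈ interior (Dom a b)) (hf1 : f 1 = 0) (hne : Γ.Nonempty)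
    (hmeas : ∀ h ∈ Γ, Measurable h) (hbd : ∀ h ∈ Γ, ∀ x, h x ∈ Icc α β)
    (Q P : Measure X) [IsProbabilityMeasure Q] [IsProbabilityMeasure P] :
    α - β ≤ Dfg f a b Γ Q P := by
  obtain ⟨h, hh⟩ := hne
  have h2 := integral_mem_Icc (P := Q) (hmeas h hh) (hbd h hh)
  have h3 := cgfR_mem_Icc ha0 hconv h1 hf1 (P := P) (hmeas h hh) (hbd h hh)
  linarith [h2.1, h3.2, le_Dfg ha0 hconv h1 hf1 hmeas hbd Q P hh]

lemma Dfg_mono (ha0 : 0 ≤ a) (hconv : ConvexOn ℝ (Dom a b) f)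
    (h1 : (1 : ℝ) ∈ interior (Dom a b)) (hf1 : f 1 = 0)
    (hmeas : ∀ h ∈ Γ, Measurable h) (hbd : ∀ h ∈ Γ, ∀ x, h x ∈ Icc α β)
    {Γt : Set (X → ℝ)} (hsub : Γt ⊆ Γ) (hne : Γt.Nonempty)
    (Q P : Measure X) [IsProbabilityMeasure Q] [IsProbabilityMeasure P] :
    Dfg f a b Γt Q P ≤ Dfg f a b Γ Q P :=
  Dfg_le hne fun _ hh => le_Dfg ha0 hconv h1 hf1 hmeas hbd Q P (hsub hh)

lemma Dfg_le_Dfg_add_approxErr (ha0 : 0 ≤ a) (hconv : ConvexOn ℝ (Dom a b) f)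
    (h1 : (1 : ℝ) ∈ interior (Dom a b)) (hf1 : f 1 = 0)
    (hmeas : ∀ h ∈ Γ, Measurable h) (hbd : ∀ h ∈ Γ, ∀ x, h x ∈ Icc α β)
    {Γt : Set (X → ℝ)} (hsub : Γt ⊆ Γ) (hne : Γt.Nonempty)
    (Q P : Measure X) [IsProbabilityMeasure Q] [IsProbabilityMeasure P] :
    Dfg f a b Γ Q P ≤ Dfg f a b Γt Q P + 2 * approxErr Γ Γt := by
  have : Nonempty X := nonempty_of_isProbabilityMeasure Q
  refine Dfg_le (hne.mono hsub) fun h hh => le_of_forall_pos_le_add fun ε hε => ?_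
  obtain ⟨ht, hht, hlt⟩ := exists_abs_sub_lt_of_approxErr_lt hsub hne hbd
    (show approxErr Γ Γt < approxErr Γ Γt + ε / 2 by linarith) hh
  have hm := hmeas h hh
  have hmt := hmeas ht (hsub hht)
  have hb := hbd h hh
  have hbt := hbd ht (hsub hht)
  have h2 := cgfR_le_cgfR_add ha0 hconv h1 hf1 (P := P) (c := approxErr Γ Γt + ε / 2)
    hmt hbt hm hb fun x => by linarith [(abs_lt.1 (hlt x)).1]
  have h3 : ∫ x, h x ∂Q ≤ ∫ x, ht x ∂Q + (approxErr Γ Γt + ε / 2) := by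
    have hit := integrable_of_mem_Icc (P := Q) hmt hbt
    have := integral_mono (integrable_of_mem_Icc (P := Q) hm hb)
      (hit.add (integrable_const (approxErr Γ Γt + ε / 2)))
      fun x => show h x ≤ ht x + (approxErr Γ Γt + ε / 2) by linarith [(abs_lt.1 (hlt x)).2]
    simpa [integral_add hit (integrable_const _)] using this
  have h4 := le_Dfg ha0 hconv h1 hf1 (fun h hh => hmeas h (hsub hh))
    (fun h hh => hbd h (hsub hh)) Q P hht
  linarith

end Divergence

open MeasureTheory in
/-- Reverse `(f,Γ)`-GAN error decomposition. -/
theorem stmt17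
    {X : Type*} [TopologicalSpace X] [MeasurableSpace X] [BorelSpace X]
    (f : ℝ → ℝ) (a : ℝ) (b : EReal) (α β : ℝ)
    (ha0 : 0 ≤ a) (ha1 : a < 1) (hb1 : ((1 : ℝ) : EReal) < b)
    (hconv : ConvexOn ℝ (Dom a b) f) (hf1 : f 1 = 0)
    (hstrict : ∃ ε > 0, Set.Ioo (1 - ε) (1 + ε) ⊆ Dom a b ∧
      StrictConvexOn ℝ (Set.Ioo (1 - ε) (1 + ε)) f)
    (hz : zz f + β - α ∈ interior {z : ℝ | fStar f a b z < ⊤})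
    (hαβ : α ≤ β)
    (Γt Γ : Set (X → ℝ)) (hsub : Γt ⊆ Γ) (hΓtne : Γt.Nonempty)
    (hcont : ∀ h ∈ Γ, Continuous h) (hbd : ∀ h ∈ Γ, ∀ x, h x ∈ Set.Icc α β)
    (hΓd : PtwiseDenseCount Γ) (hΓtd : PtwiseDenseCount Γt)
    {Z : Type*} [MeasurableSpace Z] (PZ : Measure Z) [IsProbabilityMeasure PZ]
    {Θ : Type*} [MetricSpace Θ] [TopologicalSpace.SeparableSpace Θ] [Nonempty Θ]
    [MeasurableSpace Θ] [BorelSpace Θ]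
    (Φ : Θ → Z → X) (hΦm : ∀ θ, Measurable (Φ θ)) (hΦc : ∀ z, Continuous fun θ => Φ θ z)
    (Q : Measure X) [IsProbabilityMeasure Q]
    {Ω : Type*} [MeasurableSpace Ω] (ℙ : Measure Ω) [IsProbabilityMeasure ℙ]
    (n m : ℕ) (hn : 0 < n) (hm : 0 < m)
    (Xs : Fin n → Ω → X) (Zs : Fin m → Ω → Z)
    (hXm : ∀ i, Measurable (Xs i)) (hZm : ∀ j, Measurable (Zs j))
    (hlaw : Measure.map (fun ω => (fun i => Xs i ω, fun j => Zs j ω)) ℙ =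
      (Measure.pi fun _ : Fin n => Q).prod (Measure.pi fun _ : Fin m => PZ))
    (θstar : Ω → Θ) (hθm : Measurable θstar)
    (εopt : ℝ) (hεopt : 0 ≤ εopt)
    (hopt : ∀ᵐ ω ∂ℙ,
      Dfg f a b Γt (Measure.map (Φ (θstar ω)) (empMeas m fun j => Zs j ω))
          (empMeas n fun i => Xs i ω) ≤
        (⨅ θ : Θ, Dfg f a b Γt (Measure.map (Φ θ) (empMeas m fun j => Zs j ω))
          (empMeas n fun i => Xs i ω)) + εopt) :
    ∀ᵐ ω ∂ℙ,
      Dfg f a b Γ (Measure.map (Φ (θstar ω)) PZ) Q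
          - (⨅ θ : Θ, Dfg f a b Γ (Measure.map (Φ θ) PZ) Q) ≤
        sSup {r : ℝ | ∃ h ∈ Γt, ∃ θ : Θ,
            r = (∫ z, h (Φ θ z) ∂PZ) - ∫ z, h (Φ θ z) ∂(empMeas m fun j => Zs j ω)}
        + sSup {r : ℝ | ∃ h ∈ Γt, ∃ θ : Θ,
            r = (∫ z, h (Φ θ z) ∂(empMeas m fun j => Zs j ω)) - ∫ z, h (Φ θ z) ∂PZ}
        + sSup {r : ℝ | ∃ h ∈ Γt,
            r = cgfR f a b (empMeas n fun i => Xs i ω) h - cgfR f a b Q h}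
        + sSup {r : ℝ | ∃ h ∈ Γt,
            r = cgfR f a b Q h - cgfR f a b (empMeas n fun i => Xs i ω) h}
        + (1 + rderiv (fStarR f a b) (zz f + β - α)) * approxErr Γ Γt
        + εopt := by
  have h1 : (1 : ℝ) ∈ interior (Dom a b) := by
    obtain ⟨ε, hε, hss, -⟩ := hstrict
    exact mem_interior.2 ⟨_, hss, isOpen_Ioo, by constructor <;> linarith⟩
  have hK : 1 ≤ rderiv (fStarR f a b) (zz f + β - α) :=
    one_le_rderiv_fStarR hconv hf1 h1 (by linarith) hz
  have hmeas : ∀ h ∈ Γ, Measurable h := fun h hh => (hcont h hh).measurable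
  have hmeast : ∀ h ∈ Γt, Measurable h := fun h hh => hmeas h (hsub hh)
  have hbdt : ∀ h ∈ Γt, ∀ x, h x ∈ Set.Icc α β := fun h hh => hbd h (hsub hh)
  filter_upwards [hopt] with ω hω
  have hPm := isProbabilityMeasure_empMeas hm fun j => Zs j ω
  have hQn := isProbabilityMeasure_empMeas hn fun i => Xs i ω
  set Pm := empMeas m fun j => Zs j ω
  set Qn := empMeas n fun i => Xs i ω
  have hmap (θ : Θ) : IsProbabilityMeasure (Measure.map (Φ θ) PZ) :=
    Measure.isProbabilityMeasure_map (hΦm θ).aemeasurable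
  have hmapm (θ : Θ) : IsProbabilityMeasure (Measure.map (Φ θ) Pm) :=
    Measure.isProbabilityMeasure_map (hΦm θ).aemeasurable
  have hint (P : Measure Z) (θ : Θ) (h : X → ℝ) (hh : h ∈ Γt) :
      ∫ x, h x ∂(Measure.map (Φ θ) P) = ∫ z, h (Φ θ z) ∂P :=
    integral_map (hΦm θ).aemeasurable (hmeast h hh).aestronglyMeasurable
  have hE (P : Measure Z) [IsProbabilityMeasure P] (θ : Θ) (h : X → ℝ) (hh : h ∈ Γt) :
      ∫ z, h (Φ θ z) ∂P ∈ Set.Icc α β :=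
    integral_mem_Icc ((hmeast h hh).comp (hΦm θ)) fun z => hbdt h hh (Φ θ z)
  have hΛ (P : Measure X) [IsProbabilityMeasure P] (h : X → ℝ) (hh : h ∈ Γt) :
      cgfR f a b P h ∈ Set.Icc α β :=
    cgfR_mem_Icc ha0 hconv h1 hf1 (hmeast h hh) (hbdt h hh)
  have hES (P P' : Measure Z) [IsProbabilityMeasure P] [IsProbabilityMeasure P'] (θ : Θ)
      (h : X → ℝ) (hh : h ∈ Γt) : (∫ z, h (Φ θ z) ∂P) - ∫ z, h (Φ θ z) ∂P' ≤
        sSup {r : ℝ | ∃ h ∈ Γt, ∃ θ : Θ,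
          r = (∫ z, h (Φ θ z) ∂P) - ∫ z, h (Φ θ z) ∂P'} := by
    refine le_csSup ⟨β - α, ?_⟩ ⟨h, hh, θ, rfl⟩
    rintro _ ⟨h, hh, θ, rfl⟩
    linarith [(hE P θ h hh).2, (hE P' θ h hh).1]
  have hΛS (P P' : Measure X) [IsProbabilityMeasure P] [IsProbabilityMeasure P']
      (h : X → ℝ) (hh : h ∈ Γt) : cgfR f a b P h - cgfR f a b P' h ≤
        sSup {r : ℝ | ∃ h ∈ Γt, r = cgfR f a b P h - cgfR f a b P' h} := by
    refine le_csSup ⟨β - α, ?_⟩ ⟨h, hh, rfl⟩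
    rintro _ ⟨h, hh, rfl⟩
    linarith [(hΛ P h hh).2, (hΛ P' h hh).1]
  have happrox := Dfg_le_Dfg_add_approxErr ha0 hconv h1 hf1 hmeas hbd hsub hΓtne
    (Measure.map (Φ (θstar ω)) PZ) Q
  have hpop : Dfg f a b Γt (Measure.map (Φ (θstar ω)) PZ) Q ≤
      Dfg f a b Γt (Measure.map (Φ (θstar ω)) Pm) Qn
        + sSup {r : ℝ | ∃ h ∈ Γt, ∃ θ : Θ,
            r = (∫ z, h (Φ θ z) ∂PZ) - ∫ z, h (Φ θ z) ∂Pm}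
        + sSup {r : ℝ | ∃ h ∈ Γt, r = cgfR f a b Qn h - cgfR f a b Q h} := by
    refine Dfg_le hΓtne fun h hh => ?_
    have h2 := le_Dfg ha0 hconv h1 hf1 hmeast hbdt (Measure.map (Φ (θstar ω)) Pm) Qn hh
    rw [hint _ _ _ hh] at h2 ⊢
    linarith [hES PZ Pm (θstar ω) h hh, hΛS Qn Q h hh]
  have hinf : (⨅ θ : Θ, Dfg f a b Γt (Measure.map (Φ θ) Pm) Qn)
        - sSup {r : ℝ | ∃ h ∈ Γt, ∃ θ : Θ,
            r = (∫ z, h (Φ θ z) ∂Pm) - ∫ z, h (Φ θ z) ∂PZ}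
        - sSup {r : ℝ | ∃ h ∈ Γt, r = cgfR f a b Q h - cgfR f a b Qn h} ≤
      ⨅ θ : Θ, Dfg f a b Γ (Measure.map (Φ θ) PZ) Q := by
    refine le_ciInf fun θ => ?_
    have hbelow : BddBelow (Set.range fun θ : Θ => Dfg f a b Γt (Measure.map (Φ θ) Pm) Qn) := by
      refine ⟨α - β, ?_⟩
      rintro _ ⟨θ, rfl⟩
      exact sub_le_Dfg ha0 hconv h1 hf1 hΓtne hmeast hbdt _ _
    have hemp : Dfg f a b Γt (Measure.map (Φ θ) Pm) Qn ≤
        Dfg f a b Γt (Measure.map (Φ θ) PZ) Q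
        + sSup {r : ℝ | ∃ h ∈ Γt, ∃ θ : Θ,
            r = (∫ z, h (Φ θ z) ∂Pm) - ∫ z, h (Φ θ z) ∂PZ}
        + sSup {r : ℝ | ∃ h ∈ Γt, r = cgfR f a b Q h - cgfR f a b Qn h} := by
      refine Dfg_le hΓtne fun h hh => ?_
      have h2 := le_Dfg ha0 hconv h1 hf1 hmeast hbdt (Measure.map (Φ θ) PZ) Q hh
      rw [hint _ _ _ hh] at h2 ⊢
      linarith [hES Pm PZ θ h hh, hΛS Q Qn h hh]
    linarith [ciInf_le hbelow θ,
      Dfg_mono ha0 hconv h1 hf1 hmeas hbd hsub hΓtne (Measure.map (Φ θ) PZ) Q]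
  have hcoef := mul_le_mul_of_nonneg_right hK (approxErr_nonneg Γ Γt)
  linarith
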